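/- arXiv:2101.07862 — 6 statements merged into one kernel-verified Lean document; each statement's English description precedes it below -/
import Mathlib

section
/- Let a₁, a₂ ∈ ℝ³ be linearly independent, a₃ = (a₁ × a₂)/‖a₁ × a₂‖, let w₁, w₂ ∈ ℝ³ satisfy a₃·w₁ = a₃·w₂ = 0, let σ₁, σ₂ ∈ ℝ and τ ≠ 0, and set ã₁ = a₁ + w₁, ã₂ = a₂ + w₂. Define A = (a₁·ã₁)(a₂·ã₂) − (a₁·ã₂)(a₂·ã₁) and assume A ≠ 0. Then the 3×3 real matrix J whose columns are c₁ = a₁ + σ₁a₃ + w₁, c₂ = a₂ + σ₂a₃ + w₂ and c₃ = τ·a₃ is invertible, and its inverse is the matrix whose rows are r₁ = (1/A)[(a₂·ã₂)a₁ − (a₁·ã₂)a₂], r₂ = (1/A)[−(a₂·ã₁)a₁ + (a₁·ã₁)a₂], and r₃ = −(σ₁/τ)r₁ − (σ₂/τ)r₂ + (1/τ)a₃. (This is the coordinate-free content of the inverse-Jacobian formulas for the change of variables x^ε = X + εξ₃hN, with w_j = εξ₃h·∂a₃/∂ξ_j, σ_j = εξ₃·∂h/∂ξ_j, τ = εh.)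 -/
noncomputable section

/-- Euclidean dot product on `ℝ³` (as `Fin 3 → ℝ`). -/
def dot3 (a b : Fin 3 → ℝ) : ℝ := a 0 * b 0 + a 1 * b 1 + a 2 * b 2

/-- Cross product on `ℝ³`. -/
def cross3 (a b : Fin 3 → ℝ) : Fin 3 → ℝ :=
  ![a 1 * b 2 - a 2 * b 1, a 2 * b 0 - a 0 * b 2, a 0 * b 1 - a 1 * b 0]

/-- Euclidean norm on `ℝ³`. -/
def norm3 (a : Fin 3 → ℝ) : ℝ := Real.sqrt (dot3 a a)

theorem dot3_add_right (a b c : Fin 3 → ℝ) : dot3 a (b + c) = dot3 a b + dot3 a c := by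
  simp [dot3]; ring

theorem dot3_add_left (a b c : Fin 3 → ℝ) : dot3 (a + b) c = dot3 a c + dot3 b c := by
  simp [dot3]; ring

theorem dot3_sub_left (a b c : Fin 3 → ℝ) : dot3 (a - b) c = dot3 a c - dot3 b c := by
  simp [dot3]; ring

theorem dot3_smul_right (k : ℝ) (a b : Fin 3 → ℝ) : dot3 a (k • b) = k * dot3 a b := by
  simp [dot3]; ring

theorem dot3_smul_left (k : ℝ) (a b : Fin 3 → ℝ) : dot3 (k • a) b = k * dot3 a b := by
  simp [dot3]; ring

theorem dot3_comm (a b : Fin 3 → ℝ) : dot3 a b = dot3 b a := by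
  simp [dot3]; ring

theorem dot3_cross_left (a b : Fin 3 → ℝ) : dot3 (cross3 a b) a = 0 := by
  simp [dot3, cross3]; ring

theorem dot3_cross_right (a b : Fin 3 → ℝ) : dot3 (cross3 a b) b = 0 := by
  simp [dot3, cross3]; ring

theorem dot3_binet (a b c d : Fin 3 → ℝ) :
    dot3 a c * dot3 b d - dot3 a d * dot3 b c = dot3 (cross3 a b) (cross3 c d) := by
  simp [dot3, cross3]; ring

theorem dot3_self_pos (a b : Fin 3 → ℝ) (h : dot3 a b ≠ 0) : 0 < dot3 a a := by
  have h0 : 0 ≤ dot3 a a := by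
    unfold dot3; nlinarith [sq_nonneg (a 0), sq_nonneg (a 1), sq_nonneg (a 2)]
  refine lt_of_le_of_ne h0 fun h1 => h ?_
  unfold dot3 at h1
  have e0 : a 0 = 0 := by nlinarith [sq_nonneg (a 0), sq_nonneg (a 1), sq_nonneg (a 2)]
  have e1 : a 1 = 0 := by nlinarith [sq_nonneg (a 0), sq_nonneg (a 1), sq_nonneg (a 2)]
  have e2 : a 2 = 0 := by nlinarith [sq_nonneg (a 0), sq_nonneg (a 1), sq_nonneg (a 2)]
  simp [dot3, e0, e1, e2]

/-- The coordinate-free content of the inverse-Jacobian formulas: the matrix `J` with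
columns `c₁ = a₁ + σ₁a₃ + w₁`, `c₂ = a₂ + σ₂a₃ + w₂`, `c₃ = τ·a₃` is invertible, with
inverse the matrix whose rows are `r₁`, `r₂`, `r₃` as below. -/
theorem stmt4
    (a₁ a₂ : Fin 3 → ℝ) (hli : LinearIndependent ℝ ![a₁, a₂])
    (a₃ : Fin 3 → ℝ)
    (ha₃ : a₃ = (norm3 (cross3 a₁ a₂))⁻¹ • cross3 a₁ a₂)
    (w₁ w₂ : Fin 3 → ℝ) (hw₁ : dot3 a₃ w₁ = 0) (hw₂ : dot3 a₃ w₂ = 0)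
    (σ₁ σ₂ τ : ℝ) (hτ : τ ≠ 0)
    (ta₁ ta₂ : Fin 3 → ℝ) (hta₁ : ta₁ = a₁ + w₁) (hta₂ : ta₂ = a₂ + w₂)
    (A : ℝ)
    (hA : A = dot3 a₁ ta₁ * dot3 a₂ ta₂ - dot3 a₁ ta₂ * dot3 a₂ ta₁)
    (hA0 : A ≠ 0)
    (r₁ r₂ r₃ : Fin 3 → ℝ)
    (hr₁ : r₁ = A⁻¹ • (dot3 a₂ ta₂ • a₁ - dot3 a₁ ta₂ • a₂))
    (hr₂ : r₂ = A⁻¹ • (-(dot3 a₂ ta₁) • a₁ + dot3 a₁ ta₁ • a₂))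
    (hr₃ : r₃ = -(σ₁ / τ) • r₁ - (σ₂ / τ) • r₂ + τ⁻¹ • a₃)
    (J K : Matrix (Fin 3) (Fin 3) ℝ)
    (hJ : J.transpose = Matrix.of ![a₁ + σ₁ • a₃ + w₁, a₂ + σ₂ • a₃ + w₂, τ • a₃])
    (hK : K = Matrix.of ![r₁, r₂, r₃]) :
    IsUnit J ∧ J⁻¹ = K := by
  have hpos : 0 < dot3 (cross3 a₁ a₂) (cross3 a₁ a₂) := by
    apply dot3_self_pos _ (cross3 ta₁ ta₂)
    rw [← dot3_binet, ← hA]; exact hA0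
  have h31 : dot3 a₃ a₁ = 0 := by rw [ha₃, dot3_smul_left, dot3_cross_left, mul_zero]
  have h32 : dot3 a₃ a₂ = 0 := by rw [ha₃, dot3_smul_left, dot3_cross_right, mul_zero]
  have h13 : dot3 a₁ a₃ = 0 := by rw [dot3_comm, h31]
  have h23 : dot3 a₂ a₃ = 0 := by rw [dot3_comm, h32]
  have h33 : dot3 a₃ a₃ = 1 := by
    rw [ha₃, dot3_smul_left, dot3_smul_right, norm3]
    have hs := Real.mul_self_sqrt hpos.le
    have hs0 := (Real.sqrt_pos.2 hpos).ne'
    generalize Real.sqrt (dot3 (cross3 a₁ a₂) (cross3 a₁ a₂)) = s at hs hs0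
    rw [← hs]
    field_simp
  clear ha₃ hli
  have r1t1 : dot3 r₁ ta₁ = 1 := by
    rw [hr₁, dot3_smul_left, dot3_sub_left, dot3_smul_left, dot3_smul_left,
      inv_mul_eq_one₀ hA0, hA]; ring
  have r1t2 : dot3 r₁ ta₂ = 0 := by
    rw [hr₁, dot3_smul_left, dot3_sub_left, dot3_smul_left, dot3_smul_left]; ring
  have r2t1 : dot3 r₂ ta₁ = 0 := by
    rw [hr₂, dot3_smul_left, dot3_add_left, dot3_smul_left, dot3_smul_left]; ring
  have r2t2 : dot3 r₂ ta₂ = 1 := by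
    rw [hr₂, dot3_smul_left, dot3_add_left, dot3_smul_left, dot3_smul_left,
      inv_mul_eq_one₀ hA0, hA]; ring
  have r13 : dot3 r₁ a₃ = 0 := by
    rw [hr₁, dot3_smul_left, dot3_sub_left, dot3_smul_left, dot3_smul_left, h13, h23]; ring
  have r23 : dot3 r₂ a₃ = 0 := by
    rw [hr₂, dot3_smul_left, dot3_add_left, dot3_smul_left, dot3_smul_left, h13, h23]; ring
  have a3t1 : dot3 a₃ ta₁ = 0 := by rw [hta₁, dot3_add_right, h31, hw₁, add_zero]
  have a3t2 : dot3 a₃ ta₂ = 0 := by rw [hta₂, dot3_add_right, h32, hw₂, add_zero]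
  have c1 : a₁ + σ₁ • a₃ + w₁ = ta₁ + σ₁ • a₃ := by rw [hta₁]; abel
  have c2 : a₂ + σ₂ • a₃ + w₂ = ta₂ + σ₂ • a₃ := by rw [hta₂]; abel
  rw [c1, c2] at hJ
  have key : ∀ i j, (K * J) i j = dot3 (K i) (J.transpose j) := by
    intro i j
    simp [Matrix.mul_apply, Fin.sum_univ_three, dot3]
  have K0 : K 0 = r₁ := by rw [hK]; rfl
  have K1 : K 1 = r₂ := by rw [hK]; rfl
  have K2 : K 2 = r₃ := by rw [hK]; rfl
  have J0 : J.transpose 0 = ta₁ + σ₁ • a₃ := by rw [hJ]; rfl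
  have J1 : J.transpose 1 = ta₂ + σ₂ • a₃ := by rw [hJ]; rfl
  have J2 : J.transpose 2 = τ • a₃ := by rw [hJ]; rfl
  have hKJ : K * J = 1 := by
    ext i j
    rw [key]
    fin_cases i <;> fin_cases j <;>
      simp [K0, K1, K2, J0, J1, J2, hr₃, dot3_add_right, dot3_smul_right, dot3_add_left,
        dot3_sub_left, dot3_smul_left, -neg_smul, -Matrix.transpose_apply,
        r1t1, r1t2, r2t1, r2t2, r13, r23, a3t1, a3t2, h33, hτ]
    all_goals (field_simp; try ring)
  exact ⟨IsUnit.of_mul_eq_one_right K hKJ, Matrix.inv_eq_left_inv hKJ⟩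
end
end

section
/- Let μ > 0 and let h, p, V₁, V₂, W₁, W₂ : D × (0,T) → ℝ be smooth with h > 0. Define on D × [0,1] × (0,T): u₁ = (h²(ξ₃² − ξ₃)/(2μA⁰))(G·∂p/∂ξ₁ − F·∂p/∂ξ₂) + ξ₃(W₁ − V₁) + V₁, u₂ = (h²(ξ₃² − ξ₃)/(2μA⁰))(E·∂p/∂ξ₂ − F·∂p/∂ξ₁) + ξ₃(W₂ − V₂) + V₂, and u₃ = (∂X/∂t)·a₃. Assume there exists w : D × [0,1] × (0,T) → ℝ, differentiable in ξ₃, with w = 0 on ξ₃ = 0, w = ∂h/∂t on ξ₃ = 1, satisfying on D × (0,1) × (0,T) the incompressibility relation (1/h)·∂w/∂ξ₃ = −(∂A⁰/∂ξ₁/(2A⁰))·u₁ − (∂A⁰/∂ξ₂/(2A⁰))·u₂ − (A¹/A⁰)·u₃ − ∂u₁/∂ξ₁ − ∂u₂/∂ξ₂ + (ξ₃/h)·(∂u₁/∂ξ₃·∂h/∂ξ₁ + ∂u₂/∂ξ₃·∂h/∂ξ₂). Then p satisfies the generalized Reynolds equation on D × (0,T): (1/√A⁰)·div((h³/√A⁰)·M∇p)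 = 12μ·∂h/∂t + 12μ·(hA¹/A⁰)·((∂X/∂t)·a₃) − 6μ·∇h·(W − V) + (6μh/√A⁰)·div(√A⁰·(W + V)), where M is the 2×2 matrix with rows (G, −F) and (−F, E), V = (V₁, V₂), W = (W₁, W₂). -/
noncomputable section

/-- Partial derivative in `ξ₁` of a map on `ℝ × ℝ × ℝ` (coordinates `(ξ₁, ξ₂, t)`). -/
def pd1 {E : Type*} [NormedAddCommGroup E] [NormedSpace ℝ E]
    (f : ℝ × ℝ × ℝ → E) (q : ℝ × ℝ × ℝ) : E := fderiv ℝ f q (1, 0, 0)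

/-- Partial derivative in `ξ₂`. -/
def pd2 {E : Type*} [NormedAddCommGroup E] [NormedSpace ℝ E]
    (f : ℝ × ℝ × ℝ → E) (q : ℝ × ℝ × ℝ) : E := fderiv ℝ f q (0, 1, 0)

/-- Partial derivative in `t`. -/
def pdt {E : Type*} [NormedAddCommGroup E] [NormedSpace ℝ E]
    (f : ℝ × ℝ × ℝ → E) (q : ℝ × ℝ × ℝ) : E := fderiv ℝ f q (0, 0, 1)

lemma aux_line {f : ℝ × ℝ × ℝ → ℝ} {q : ℝ × ℝ × ℝ} (hf : DifferentiableAt ℝ f q)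
    (v : ℝ × ℝ × ℝ) : HasDerivAt (fun t : ℝ => f (q + t • v)) (fderiv ℝ f q v) 0 :=
  hf.hasFDerivAt.hasLineDerivAt v

lemma aux_line_eq {f : ℝ × ℝ × ℝ → ℝ} {q : ℝ × ℝ × ℝ} (hf : DifferentiableAt ℝ f q)
    {v : ℝ × ℝ × ℝ} {d : ℝ} (hd : HasDerivAt (fun t : ℝ => f (q + t • v)) d 0) :
    fderiv ℝ f q v = d :=
  (aux_line hf v).unique hd

lemma aux_flux {h A P : ℝ × ℝ × ℝ → ℝ} {q : ℝ × ℝ × ℝ} (v : ℝ × ℝ × ℝ)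
    (hh : DifferentiableAt ℝ h q) (hA : DifferentiableAt ℝ A q) (hP : DifferentiableAt ℝ P q)
    (hpos : 0 < A q) :
    fderiv ℝ (fun q' => h q' ^ 3 / Real.sqrt (A q') * P q') q v =
      (3 * h q ^ 2 * fderiv ℝ h q v * P q + h q ^ 3 * fderiv ℝ P q v) / Real.sqrt (A q)
        - h q ^ 3 * P q * fderiv ℝ A q v / (2 * Real.sqrt (A q) ^ 3) := by
  have hs : 0 < Real.sqrt (A q) := Real.sqrt_pos.2 hpos
  have dS : DifferentiableAt ℝ (fun q' => Real.sqrt (A q')) q := hA.sqrt hpos.ne'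
  have dQ : DifferentiableAt ℝ (fun q' => h q' ^ 3 / Real.sqrt (A q')) q :=
    by
    simp only [div_eq_mul_inv]
    exact (hh.pow 3).mul (dS.inv hs.ne')
  refine aux_line_eq (dQ.mul hP) ?_
  have e : q + (0 : ℝ) • v = q := by simp
  have := ((((aux_line hh v).pow 3).div ((aux_line hA v).sqrt (by rw [e]; exact hpos.ne'))
    (by rw [e]; exact hs.ne')).mul (aux_line hP v))
  refine this.congr_deriv ?_
  simp only [e, Pi.pow_apply, Pi.div_apply]
  field_simp
  push_cast
  ring

lemma aux_drag {A W V : ℝ × ℝ × ℝ → ℝ} {q : ℝ × ℝ × ℝ} (v : ℝ × ℝ × ℝ)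
    (hA : DifferentiableAt ℝ A q) (hW : DifferentiableAt ℝ W q) (hV : DifferentiableAt ℝ V q)
    (hpos : 0 < A q) :
    fderiv ℝ (fun q' => Real.sqrt (A q') * (W q' + V q')) q v =
      fderiv ℝ A q v / (2 * Real.sqrt (A q)) * (W q + V q)
        + Real.sqrt (A q) * (fderiv ℝ W q v + fderiv ℝ V q v) := by
  refine aux_line_eq ((hA.sqrt hpos.ne').mul (hW.add hV)) ?_
  have e : q + (0 : ℝ) • v = q := by simp
  have := ((aux_line hA v).sqrt (by rw [e]; exact hpos.ne')).mul
    ((aux_line hW v).add (aux_line hV v))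
  refine this.congr_deriv ?_
  simp only [e, Pi.add_apply]

lemma aux_vel {h A P W V : ℝ × ℝ × ℝ → ℝ} {q : ℝ × ℝ × ℝ} (v : ℝ × ℝ × ℝ) (μ x : ℝ)
    (hμ : 0 < μ)
    (hh : DifferentiableAt ℝ h q) (hA : DifferentiableAt ℝ A q) (hP : DifferentiableAt ℝ P q)
    (hW : DifferentiableAt ℝ W q) (hV : DifferentiableAt ℝ V q)
    (hpos : 0 < A q) :
    fderiv ℝ (fun q' => h q' ^ 2 * (x ^ 2 - x) / (2 * μ * A q') * P q'
        + x * (W q' - V q') + V q') q v =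
      (x ^ 2 - x) * ((2 * h q * fderiv ℝ h q v * P q + h q ^ 2 * fderiv ℝ P q v) / (2 * μ * A q)
        - h q ^ 2 * P q * fderiv ℝ A q v / (2 * μ * A q ^ 2))
        + x * (fderiv ℝ W q v - fderiv ℝ V q v) + fderiv ℝ V q v := by
  have hne : 2 * μ * A q ≠ 0 := by positivity
  have dS : DifferentiableAt ℝ (fun q' => 2 * μ * A q') q := hA.const_mul _
  have dQ : DifferentiableAt ℝ (fun q' => h q' ^ 2 * (x ^ 2 - x) / (2 * μ * A q')) q :=
    by
    simp only [div_eq_mul_inv]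
    exact ((hh.pow 2).mul_const _).mul (dS.inv hne)
  refine aux_line_eq (((dQ.mul hP).add ((hW.sub hV).const_mul x)).add hV) ?_
  have e : q + (0 : ℝ) • v = q := by simp
  have := (((((((aux_line hh v).pow 2).mul_const (x ^ 2 - x)).div
    ((aux_line hA v).const_mul (2 * μ)) (by rw [e]; exact hne)).mul (aux_line hP v)).add
    (((aux_line hW v).sub (aux_line hV v)).const_mul x)).add (aux_line hV v))
  refine this.congr_deriv ?_
  simp only [e, Pi.pow_apply, Pi.div_apply]
  field_simp
  push_cast
  ring

lemma aux_vert {K c B : ℝ} (x : ℝ) {u : ℝ → ℝ} {a b : ℝ}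
    (hu : ∀ x, u x = K * (x ^ 2 - x) / c * B + x * (a - b) + b) :
    deriv u x = K * (2 * x - 1) / c * B + (a - b) := by
  have hd : HasDerivAt u (K * (2 * x - 1) / c * B + (a - b)) x := by
    rw [funext hu]
    have h1 := (((((((hasDerivAt_id x).pow 2).sub (hasDerivAt_id x)).const_mul K).div_const
      c).mul_const B).add ((hasDerivAt_id x).mul_const (a - b))).add_const b
    refine h1.congr_deriv ?_
    simp
  exact hd.deriv

lemma aux_int {w : ℝ → ℝ} {c0 c1 c2 : ℝ} (hw : ∀ x ∈ Set.Icc (0 : ℝ) 1, DifferentiableAt ℝ w x)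
    (hd : ∀ x ∈ Set.Ioo (0 : ℝ) 1, deriv w x = c0 + c1 * x + c2 * x ^ 2) :
    w 1 - w 0 = c0 + c1 / 2 + c2 / 3 := by
  have hp : ∀ x : ℝ, HasDerivAt (fun x : ℝ => c0 * x + c1 / 2 * x ^ 2 + c2 / 3 * x ^ 3)
      (c0 + c1 * x + c2 * x ^ 2) x := by
    intro x
    have := (((hasDerivAt_id x).const_mul c0).add (((hasDerivAt_id x).pow 2).const_mul
      (c1 / 2))).add (((hasDerivAt_id x).pow 3).const_mul (c2 / 3))
    refine this.congr_deriv ?_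
    simp
    ring
  obtain ⟨c, hc, hce⟩ := exists_hasDerivAt_eq_slope
    (fun x => w x - (c0 * x + c1 / 2 * x ^ 2 + c2 / 3 * x ^ 3)) (fun _ => 0) one_pos
    (fun x hx => ((hw x hx).continuousAt.sub (hp x).continuousAt).continuousWithinAt)
    (fun x hx => ((hw x ⟨hx.1.le, hx.2.le⟩).hasDerivAt.sub (hp x)).congr_deriv
      (by rw [hd x hx]; ring))
  simp at hce
  linarith

lemma aux_dot_diff {a b : ℝ × ℝ × ℝ → Fin 3 → ℝ} {q : ℝ × ℝ × ℝ}
    (ha : DifferentiableAt ℝ a q) (hb : DifferentiableAt ℝ b q) :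
    DifferentiableAt ℝ (fun q' => dot3 (a q') (b q')) q := by
  have ha' := differentiableAt_pi.1 ha
  have hb' := differentiableAt_pi.1 hb
  exact (((ha' 0).mul (hb' 0)).add ((ha' 1).mul (hb' 1))).add ((ha' 2).mul (hb' 2))

lemma aux_dir_diff {E : Type*} [NormedAddCommGroup E] [NormedSpace ℝ E]
    {f : ℝ × ℝ × ℝ → E} {q : ℝ × ℝ × ℝ} (hf : ContDiffAt ℝ (⊤ : ℕ∞) f q) (v : ℝ × ℝ × ℝ) :
    DifferentiableAt ℝ (fun q' => fderiv ℝ f q' v) q := by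
  have h1 : ContDiffAt ℝ 1 (fderiv ℝ f) q :=
    hf.fderiv_right (m := 1) (by
      have : ((1 + 1 : ℕ∞) : WithTop ℕ∞) ≤ ((⊤ : ℕ∞) : WithTop ℕ∞) := WithTop.coe_le_coe.2 le_top
      exact this)
  exact (h1.differentiableAt one_ne_zero).clm_apply (differentiableAt_const v)

lemma aux_gram {a b : Fin 3 → ℝ} (hli : LinearIndependent ℝ ![a, b]) :
    0 < dot3 a a * dot3 b b - dot3 a b ^ 2 := by
  rw [LinearIndependent.pair_iff] at hli
  have hL : dot3 a a * dot3 b b - dot3 a b ^ 2 = (a 1 * b 2 - a 2 * b 1) ^ 2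
      + (a 2 * b 0 - a 0 * b 2) ^ 2 + (a 0 * b 1 - a 1 * b 0) ^ 2 := by
    simp only [dot3]; ring
  rcases (show 0 ≤ dot3 a a * dot3 b b - dot3 a b ^ 2 by rw [hL]; positivity).lt_or_eq with h | h
  · exact h
  exfalso
  have h0 : (dot3 b b * a 0 - dot3 a b * b 0) ^ 2 + (dot3 b b * a 1 - dot3 a b * b 1) ^ 2
      + (dot3 b b * a 2 - dot3 a b * b 2) ^ 2 = 0 := by
    have : (dot3 b b * a 0 - dot3 a b * b 0) ^ 2 + (dot3 b b * a 1 - dot3 a b * b 1) ^ 2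
      + (dot3 b b * a 2 - dot3 a b * b 2) ^ 2
      = dot3 b b * (dot3 a a * dot3 b b - dot3 a b ^ 2) := by
      simp only [dot3]; ring
    rw [this, ← h, mul_zero]
  have z0 : dot3 b b * a 0 - dot3 a b * b 0 = 0 := by
    apply pow_eq_zero_iff (two_ne_zero) |>.1
    nlinarith [sq_nonneg (dot3 b b * a 0 - dot3 a b * b 0), sq_nonneg (dot3 b b * a 1 - dot3 a b * b 1), sq_nonneg (dot3 b b * a 2 - dot3 a b * b 2)]
  have z1 : dot3 b b * a 1 - dot3 a b * b 1 = 0 := by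
    apply pow_eq_zero_iff (two_ne_zero) |>.1
    nlinarith [sq_nonneg (dot3 b b * a 0 - dot3 a b * b 0), sq_nonneg (dot3 b b * a 1 - dot3 a b * b 1), sq_nonneg (dot3 b b * a 2 - dot3 a b * b 2)]
  have z2 : dot3 b b * a 2 - dot3 a b * b 2 = 0 := by
    apply pow_eq_zero_iff (two_ne_zero) |>.1
    nlinarith [sq_nonneg (dot3 b b * a 0 - dot3 a b * b 0), sq_nonneg (dot3 b b * a 1 - dot3 a b * b 1), sq_nonneg (dot3 b b * a 2 - dot3 a b * b 2)]
  have hG : dot3 b b = 0 := by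
    refine (hli (dot3 b b) (-dot3 a b) ?_).1
    funext i
    fin_cases i <;> simp <;> linarith
  have hb : b = 0 := by
    simp only [dot3] at hG
    funext i
    fin_cases i <;> simp <;> nlinarith [sq_nonneg (b 0), sq_nonneg (b 1), sq_nonneg (b 2)]
  have := (hli 0 1 (by simp [hb])).2
  exact one_ne_zero this

set_option maxHeartbeats 4000000 in
/-- The generalized Reynolds equation: if the lubrication velocity profiles `u₁, u₂, u₃`
built from the pressure `pr` satisfy the incompressibility relation for some vertical
velocity `w` with `w = 0` on `ξ₃ = 0` and `w = ∂h/∂t` on `ξ₃ = 1`, then `pr` satisfies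
the generalized Reynolds equation on `D × (0,T)`. -/
theorem stmt7
    (D : Set (ℝ × ℝ)) (hD : IsOpen D) (T : ℝ) (hT : 0 < T)
    (S : Set (ℝ × ℝ × ℝ))
    (hSdef : S = {q : ℝ × ℝ × ℝ | (q.1, q.2.1) ∈ D ∧ q.2.2 ∈ Set.Ioo 0 T})
    (X : ℝ × ℝ × ℝ → Fin 3 → ℝ) (hX : ContDiffOn ℝ (⊤ : ℕ∞) X S)
    (a₁ a₂ a₃ : ℝ × ℝ × ℝ → Fin 3 → ℝ)
    (ha₁ : ∀ q, a₁ q = pd1 X q) (ha₂ : ∀ q, a₂ q = pd2 X q)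
    (hli : ∀ q ∈ S, LinearIndependent ℝ ![a₁ q, a₂ q])
    (ha₃ : ∀ q, a₃ q = (norm3 (cross3 (a₁ q) (a₂ q)))⁻¹ • cross3 (a₁ q) (a₂ q))
    (Ec Fc Gc A0 ec fc gc A1 : ℝ × ℝ × ℝ → ℝ)
    (hE : ∀ q, Ec q = dot3 (a₁ q) (a₁ q))
    (hF : ∀ q, Fc q = dot3 (a₁ q) (a₂ q))
    (hG : ∀ q, Gc q = dot3 (a₂ q) (a₂ q))
    (hA0 : ∀ q, A0 q = Ec q * Gc q - (Fc q) ^ 2)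
    (he : ∀ q, ec q = -dot3 (a₁ q) (pd1 a₃ q))
    (hf : ∀ q, fc q = -dot3 (a₁ q) (pd2 a₃ q))
    (hg : ∀ q, gc q = -dot3 (a₂ q) (pd2 a₃ q))
    (hA1 : ∀ q, A1 q = -(ec q) * Gc q - gc q * Ec q + 2 * fc q * Fc q)
    (μ : ℝ) (hμ : 0 < μ)
    (h pr V₁ V₂ W₁ W₂ : ℝ × ℝ × ℝ → ℝ)
    (hhs : ContDiffOn ℝ (⊤ : ℕ∞) h S) (hprs : ContDiffOn ℝ (⊤ : ℕ∞) pr S)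
    (hV₁s : ContDiffOn ℝ (⊤ : ℕ∞) V₁ S) (hV₂s : ContDiffOn ℝ (⊤ : ℕ∞) V₂ S)
    (hW₁s : ContDiffOn ℝ (⊤ : ℕ∞) W₁ S) (hW₂s : ContDiffOn ℝ (⊤ : ℕ∞) W₂ S)
    (hhpos : ∀ q ∈ S, 0 < h q)
    (u₁ u₂ : ℝ × ℝ × ℝ → ℝ → ℝ) (u₃ : ℝ × ℝ × ℝ → ℝ)
    (hu₁ : ∀ q, ∀ ξ₃ : ℝ, u₁ q ξ₃ =
        h q ^ 2 * (ξ₃ ^ 2 - ξ₃) / (2 * μ * A0 q) * (Gc q * pd1 pr q - Fc q * pd2 pr q)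
          + ξ₃ * (W₁ q - V₁ q) + V₁ q)
    (hu₂ : ∀ q, ∀ ξ₃ : ℝ, u₂ q ξ₃ =
        h q ^ 2 * (ξ₃ ^ 2 - ξ₃) / (2 * μ * A0 q) * (Ec q * pd2 pr q - Fc q * pd1 pr q)
          + ξ₃ * (W₂ q - V₂ q) + V₂ q)
    (hu₃ : ∀ q, u₃ q = dot3 (pdt X q) (a₃ q))
    (w : ℝ × ℝ × ℝ → ℝ → ℝ)
    (hwdiff : ∀ q ∈ S, ∀ ξ₃ ∈ Set.Icc (0 : ℝ) 1, DifferentiableAt ℝ (w q) ξ₃)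
    (hw0 : ∀ q ∈ S, w q 0 = 0)
    (hw1 : ∀ q ∈ S, w q 1 = pdt h q)
    (hinc : ∀ q ∈ S, ∀ ξ₃ ∈ Set.Ioo (0 : ℝ) 1,
        (1 / h q) * deriv (w q) ξ₃ =
          -(pd1 A0 q / (2 * A0 q)) * u₁ q ξ₃ - (pd2 A0 q / (2 * A0 q)) * u₂ q ξ₃
            - (A1 q / A0 q) * u₃ q
            - pd1 (fun q' => u₁ q' ξ₃) q - pd2 (fun q' => u₂ q' ξ₃) q
            + (ξ₃ / h q) * (deriv (u₁ q) ξ₃ * pd1 h q + deriv (u₂ q) ξ₃ * pd2 h q)) :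
    ∀ q ∈ S,
      (1 / Real.sqrt (A0 q)) *
          (pd1 (fun q' => h q' ^ 3 / Real.sqrt (A0 q')
              * (Gc q' * pd1 pr q' - Fc q' * pd2 pr q')) q
            + pd2 (fun q' => h q' ^ 3 / Real.sqrt (A0 q')
              * (-(Fc q') * pd1 pr q' + Ec q' * pd2 pr q')) q)
        = 12 * μ * pdt h q
          + 12 * μ * (h q * A1 q / A0 q) * dot3 (pdt X q) (a₃ q)
          - 6 * μ * (pd1 h q * (W₁ q - V₁ q) + pd2 h q * (W₂ q - V₂ q))
          + (6 * μ * h q / Real.sqrt (A0 q)) *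
              (pd1 (fun q' => Real.sqrt (A0 q') * (W₁ q' + V₁ q')) q
                + pd2 (fun q' => Real.sqrt (A0 q') * (W₂ q' + V₂ q')) q) := by
  intro q hq
  have hSo : IsOpen S := by
    rw [hSdef]
    have c1 : Continuous (fun q : ℝ × ℝ × ℝ => (q.1, q.2.1)) := by fun_prop
    have c2 : Continuous (fun q : ℝ × ℝ × ℝ => q.2.2) := by fun_prop
    exact (hD.preimage c1).inter (isOpen_Ioo.preimage c2)
  have hn : S ∈ nhds q := hSo.mem_nhds hq
  have top_ne : ((⊤ : ℕ∞) : WithTop ℕ∞) ≠ 0 := by simp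
  have dh := (hhs.contDiffAt hn).differentiableAt top_ne
  have dV₁ := (hV₁s.contDiffAt hn).differentiableAt top_ne
  have dV₂ := (hV₂s.contDiffAt hn).differentiableAt top_ne
  have dW₁ := (hW₁s.contDiffAt hn).differentiableAt top_ne
  have dW₂ := (hW₂s.contDiffAt hn).differentiableAt top_ne
  have dp1 : DifferentiableAt ℝ (pd1 pr) q := aux_dir_diff (hprs.contDiffAt hn) _
  have dp2 : DifferentiableAt ℝ (pd2 pr) q := aux_dir_diff (hprs.contDiffAt hn) _
  have da₁ : DifferentiableAt ℝ a₁ q := by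
    rw [funext ha₁]; exact aux_dir_diff (hX.contDiffAt hn) _
  have da₂ : DifferentiableAt ℝ a₂ q := by
    rw [funext ha₂]; exact aux_dir_diff (hX.contDiffAt hn) _
  have dE : DifferentiableAt ℝ Ec q := by rw [funext hE]; exact aux_dot_diff da₁ da₁
  have dF : DifferentiableAt ℝ Fc q := by rw [funext hF]; exact aux_dot_diff da₁ da₂
  have dG : DifferentiableAt ℝ Gc q := by rw [funext hG]; exact aux_dot_diff da₂ da₂
  have dA : DifferentiableAt ℝ A0 q := by
    rw [funext hA0]; exact (dE.mul dG).sub (dF.pow 2)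
  have hA : 0 < A0 q := by
    rw [hA0, hE, hF, hG]; exact aux_gram (hli q hq)
  have hh0 := hhpos q hq
  obtain ⟨P₁, hP₁⟩ : ∃ P : ℝ × ℝ × ℝ → ℝ, P = fun q' => Gc q' * pd1 pr q' - Fc q' * pd2 pr q' :=
    ⟨_, rfl⟩
  obtain ⟨P₂, hP₂⟩ : ∃ P : ℝ × ℝ × ℝ → ℝ, P = fun q' => Ec q' * pd2 pr q' - Fc q' * pd1 pr q' :=
    ⟨_, rfl⟩
  have dP₁ : DifferentiableAt ℝ P₁ q := by
    rw [hP₁]; exact (dG.mul dp1).sub (dF.mul dp2)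
  have dP₂ : DifferentiableAt ℝ P₂ q := by
    rw [hP₂]; exact (dE.mul dp2).sub (dF.mul dp1)
  have hu₁' : ∀ q, ∀ x : ℝ, u₁ q x =
      h q ^ 2 * (x ^ 2 - x) / (2 * μ * A0 q) * P₁ q + x * (W₁ q - V₁ q) + V₁ q := by
    intro q x; rw [hu₁, hP₁]
  have hu₂' : ∀ q, ∀ x : ℝ, u₂ q x =
      h q ^ 2 * (x ^ 2 - x) / (2 * μ * A0 q) * P₂ q + x * (W₂ q - V₂ q) + V₂ q := by
    intro q x; rw [hu₂, hP₂]
  have f1 : (fun q' => h q' ^ 3 / Real.sqrt (A0 q') * (Gc q' * pd1 pr q' - Fc q' * pd2 pr q'))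
      = fun q' => h q' ^ 3 / Real.sqrt (A0 q') * P₁ q' := by rw [hP₁]
  have f2 : (fun q' => h q' ^ 3 / Real.sqrt (A0 q') * (-(Fc q') * pd1 pr q' + Ec q' * pd2 pr q'))
      = fun q' => h q' ^ 3 / Real.sqrt (A0 q') * P₂ q' := by
    rw [hP₂]; funext q'; ring
  rw [f1, f2, ← hu₃]
  have hi := hinc q hq
  have k1 := fun x => (congrArg (fun F => pd1 F q) (funext (fun q' => hu₁' q' x))).trans
    (aux_vel (1, 0, 0) μ x hμ dh dA dP₁ dW₁ dV₁ hA)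
  have k2 := fun x => (congrArg (fun F => pd2 F q) (funext (fun q' => hu₂' q' x))).trans
    (aux_vel (0, 1, 0) μ x hμ dh dA dP₂ dW₂ dV₂ hA)
  have j1 := fun x => aux_vert x (hu₁' q)
  have j2 := fun x => aux_vert x (hu₂' q)
  simp only [k1, k2, j1, j2] at hi
  simp only [hu₁', hu₂'] at hi
  have r1 := aux_flux (1, 0, 0) dh dA dP₁ hA
  have r2 := aux_flux (0, 1, 0) dh dA dP₂ hA
  have r3 := aux_drag (1, 0, 0) dA dW₁ dV₁ hA
  have r4 := aux_drag (0, 1, 0) dA dW₂ dV₂ hA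
  have hI := fun c0 c1 c2 => aux_int (c0 := c0) (c1 := c1) (c2 := c2) (hwdiff q hq)
  rw [hw0 q hq, hw1 q hq] at hI
  simp only [pd1, pd2] at hi ⊢
  rw [r1, r2, r3, r4]
  have hs : 0 < Real.sqrt (A0 q) := Real.sqrt_pos.2 hA
  have hsA : A0 q = Real.sqrt (A0 q) ^ 2 := (Real.sq_sqrt hA.le).symm
  clear r1 r2 r3 r4 f1 f2 k1 k2 j1 j2
  generalize pdt h q = ht at *
  generalize fderiv ℝ A0 q (1, 0, 0) = A01 at *
  generalize fderiv ℝ A0 q (0, 1, 0) = A02 at *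
  generalize fderiv ℝ h q (1, 0, 0) = h1 at *
  generalize fderiv ℝ h q (0, 1, 0) = h2 at *
  generalize fderiv ℝ P₁ q (1, 0, 0) = P11 at *
  generalize fderiv ℝ P₂ q (0, 1, 0) = P22 at *
  generalize fderiv ℝ W₁ q (1, 0, 0) = W11 at *
  generalize fderiv ℝ W₂ q (0, 1, 0) = W22 at *
  generalize fderiv ℝ V₁ q (1, 0, 0) = V11 at *
  generalize fderiv ℝ V₂ q (0, 1, 0) = V22 at *
  generalize P₁ q = p1 at *
  generalize P₂ q = p2 at *
  generalize W₁ q = w1 at *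
  generalize W₂ q = w2 at *
  generalize V₁ q = v1 at *
  generalize V₂ q = v2 at *
  generalize A1 q = a1 at *
  generalize u₃ q = uu at *
  generalize h q = hh at *
  generalize w q = ww at *
  generalize Real.sqrt (A0 q) = s at *
  generalize A0 q = A at *
  subst hsA
  -- value of the slice of the right-hand side
  obtain ⟨R, hR⟩ : ∃ R : ℝ → ℝ, ∀ x, R x =
    hh * (-(A01 / (2 * s ^ 2)) * (hh ^ 2 * (x ^ 2 - x) / (2 * μ * s ^ 2) * p1 + x * (w1 - v1) + v1)
      - (A02 / (2 * s ^ 2)) * (hh ^ 2 * (x ^ 2 - x) / (2 * μ * s ^ 2) * p2 + x * (w2 - v2) + v2)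
      - (a1 / s ^ 2) * uu
      - ((x ^ 2 - x) * ((2 * hh * h1 * p1 + hh ^ 2 * P11) / (2 * μ * s ^ 2)
        - hh ^ 2 * p1 * A01 / (2 * μ * (s ^ 2) ^ 2)) + x * (W11 - V11) + V11)
      - ((x ^ 2 - x) * ((2 * hh * h2 * p2 + hh ^ 2 * P22) / (2 * μ * s ^ 2)
        - hh ^ 2 * p2 * A02 / (2 * μ * (s ^ 2) ^ 2)) + x * (W22 - V22) + V22)
      + (x / hh) * ((hh ^ 2 * (2 * x - 1) / (2 * μ * s ^ 2) * p1 + (w1 - v1)) * h1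
        + (hh ^ 2 * (2 * x - 1) / (2 * μ * s ^ 2) * p2 + (w2 - v2)) * h2)) := ⟨_, fun _ => rfl⟩
  have hdw : ∀ x ∈ Set.Ioo (0 : ℝ) 1, deriv ww x = R x := by
    intro x hx
    rw [hR, ← hi x hx]
    field_simp
  have hpoly : ∀ x, R x = R 0 + (4 * R (1 / 2) - 3 * R 0 - R 1) * x
      + (2 * R 1 + 2 * R 0 - 4 * R (1 / 2)) * x ^ 2 := by
    intro x
    simp only [hR]
    field_simp
    ring
  have hfin := hI _ _ _ (fun x hx => (hdw x hx).trans (hpoly x))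
  simp only [sub_zero] at hfin
  rw [hfin]
  simp only [hR]
  field_simp
  ring
end
end

section
/- Let a₁, a₂ ∈ ℝ³ be linearly independent, a₃ = (a₁ × a₂)/‖a₁ × a₂‖, let w₁, w₂ ∈ ℝ³ and h, c₁, c₂ ∈ ℝ. Define η = c₂(a₁ × a₃) + h(a₁ × w₂) + c₁(a₃ × a₂) + h(w₁ × a₂) and ζ = (c₁a₃ + hw₁) × (c₂a₃ + hw₂). Then the function ε ↦ ‖a₁ × a₂ + εη + ε²ζ‖ − ‖a₁ × a₂‖ − εh·[a₃·(a₁ × w₂) + a₃·(w₁ × a₂)] is O(ε²) as ε → 0. (This is the first-order expansion ‖v₃^ε‖ = ‖a₁ × a₂‖ + εh[a₃·(a₁ × ∂a₃/∂ξ₂) + a₃·(∂a₃/∂ξ₁ × a₂)] + O(ε²) of the normal to the upper surface, with w_j = ∂a₃/∂ξ_j and c_j = ∂h/∂ξ_j.) -/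
open Asymptotics

noncomputable section

theorem aux_sqrt (N L A B Z : ℝ) (hN : 0 < N) (q : ℝ → ℝ)
    (hq : ∀ ε, q ε = N ^ 2 + 2 * ε * (N * L) + ε ^ 2 * (A + ε * B + ε ^ 2 * Z))
    (hq0 : ∀ ε, 0 ≤ q ε) :
    (fun ε : ℝ => Real.sqrt (q ε) - N - ε * L) =O[nhds 0] (fun ε : ℝ => ε ^ 2) := by
  have h1 : ∀ᶠ ε : ℝ in nhds 0, |ε| < 1 := by
    have : Filter.Tendsto (fun ε : ℝ => |ε|) (nhds 0) (nhds |0|) := by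
      exact (continuous_abs).tendsto 0
    exact this.eventually (gt_mem_nhds (by simp))
  have h2 : ∀ᶠ ε : ℝ in nhds 0, |ε * L| < N / 2 := by
    have : Filter.Tendsto (fun ε : ℝ => |ε * L|) (nhds 0) (nhds |0 * L|) := by
      exact (show Continuous (fun ε : ℝ => |ε * L|) by fun_prop).tendsto 0
    exact this.eventually (gt_mem_nhds (by simpa using hN))
  refine IsBigO.of_bound (2 * (|A| + |B| + |Z| + L ^ 2) / N) ?_
  filter_upwards [h1, h2] with ε he hL
  have hs := Real.sq_sqrt (hq0 ε)
  have hs0 := Real.sqrt_nonneg (q ε)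
  set s := Real.sqrt (q ε) with hsdef
  have hD : N / 2 ≤ s + N + ε * L := by
    have := (abs_lt.1 hL).1
    linarith
  have hx : (s - N - ε * L) * (s + N + ε * L) = ε ^ 2 * (A + ε * B + ε ^ 2 * Z - L ^ 2) := by
    have := hq ε
    linear_combination hs + this
  have hp : |A + ε * B + ε ^ 2 * Z - L ^ 2| ≤ |A| + |B| + |Z| + L ^ 2 := by
    have e1 : |ε * B| ≤ |B| := by
      rw [abs_mul]
      exact mul_le_of_le_one_left (abs_nonneg _) he.le
    have e2 : |ε ^ 2 * Z| ≤ |Z| := by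
      rw [abs_mul, abs_pow]
      exact mul_le_of_le_one_left (abs_nonneg _) (pow_le_one₀ (abs_nonneg _) he.le)
    have e3 := sq_nonneg L
    have := abs_le.1 e1
    have := abs_le.1 e2
    have := abs_le.1 (le_refl |A|)
    rw [abs_le]
    constructor <;> linarith
  have hD0 : 0 < s + N + ε * L := by linarith
  have hy := congrArg abs hx
  rw [abs_mul, abs_mul, abs_of_pos hD0, abs_of_nonneg (sq_nonneg ε)] at hy
  rw [Real.norm_eq_abs, Real.norm_eq_abs, abs_of_nonneg (sq_nonneg ε), div_mul_eq_mul_div,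
    le_div_iff₀ hN]
  have k1 := mul_le_mul_of_nonneg_left hD (abs_nonneg (s - N - ε * L))
  have k2 := mul_le_mul_of_nonneg_left hp (sq_nonneg ε)
  linarith

theorem dot3_self_nonneg (a : Fin 3 → ℝ) : 0 ≤ dot3 a a := by
  unfold dot3
  nlinarith [mul_self_nonneg (a 0), mul_self_nonneg (a 1), mul_self_nonneg (a 2)]

theorem norm3_pos (a : Fin 3 → ℝ) (ha : a ≠ 0) : 0 < norm3 a := by
  apply Real.sqrt_pos.2
  refine lt_of_le_of_ne (dot3_self_nonneg a) fun h0 => ha ?_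
  unfold dot3 at h0
  have h0' := mul_self_nonneg (a 0)
  have h1' := mul_self_nonneg (a 1)
  have h2' := mul_self_nonneg (a 2)
  ext i
  fin_cases i
  · exact mul_self_eq_zero.1 (show a 0 * a 0 = 0 by linarith)
  · exact mul_self_eq_zero.1 (show a 1 * a 1 = 0 by linarith)
  · exact mul_self_eq_zero.1 (show a 2 * a 2 = 0 by linarith)

/-- First-order expansion of the norm of the (scaled) normal to the upper surface:
`‖a₁ × a₂ + εη + ε²ζ‖ − ‖a₁ × a₂‖ − εh[a₃·(a₁ × w₂) + a₃·(w₁ × a₂)] = O(ε²)` as `ε → 0`. -/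
theorem stmt9
    (a₁ a₂ : Fin 3 → ℝ) (hli : LinearIndependent ℝ ![a₁, a₂])
    (a₃ : Fin 3 → ℝ)
    (ha₃ : a₃ = (norm3 (cross3 a₁ a₂))⁻¹ • cross3 a₁ a₂)
    (w₁ w₂ : Fin 3 → ℝ) (h c₁ c₂ : ℝ)
    (η ζ : Fin 3 → ℝ)
    (hη : η = c₂ • cross3 a₁ a₃ + h • cross3 a₁ w₂ + c₁ • cross3 a₃ a₂ + h • cross3 w₁ a₂)
    (hζ : ζ = cross3 (c₁ • a₃ + h • w₁) (c₂ • a₃ + h • w₂)) :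
    (fun ε : ℝ =>
        norm3 (cross3 a₁ a₂ + ε • η + ε ^ 2 • ζ) - norm3 (cross3 a₁ a₂)
          - ε * h * (dot3 a₃ (cross3 a₁ w₂) + dot3 a₃ (cross3 w₁ a₂)))
      =O[nhds 0] (fun ε : ℝ => ε ^ 2) := by
  have hv : cross3 a₁ a₂ ≠ 0 := by
    have := crossProduct_ne_zero_iff_linearIndependent.2 hli
    rwa [cross_apply] at this
  have hN := norm3_pos _ hv
  have hNsq : norm3 (cross3 a₁ a₂) ^ 2 = dot3 (cross3 a₁ a₂) (cross3 a₁ a₂) :=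
    Real.sq_sqrt (dot3_self_nonneg _)
  have hdot : dot3 (cross3 a₁ a₂) η = norm3 (cross3 a₁ a₂) *
      (h * (dot3 a₃ (cross3 a₁ w₂) + dot3 a₃ (cross3 w₁ a₂))) := by
    generalize norm3 (cross3 a₁ a₂) = N at *
    have hNN : N * N⁻¹ = 1 := mul_inv_cancel₀ hN.ne'
    have e : N * (h * (dot3 a₃ (cross3 a₁ w₂) + dot3 a₃ (cross3 w₁ a₂)))
        = (N * N⁻¹) * (h * (dot3 (cross3 a₁ a₂) (cross3 a₁ w₂)
          + dot3 (cross3 a₁ a₂) (cross3 w₁ a₂))) := by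
      subst ha₃
      simp [dot3]
      ring
    rw [e, hNN, hη, ha₃]
    simp [dot3, cross3]
    ring
  have key := aux_sqrt (norm3 (cross3 a₁ a₂))
    (h * (dot3 a₃ (cross3 a₁ w₂) + dot3 a₃ (cross3 w₁ a₂)))
    (dot3 η η + 2 * dot3 (cross3 a₁ a₂) ζ) (2 * dot3 η ζ) (dot3 ζ ζ) hN
    (fun ε => dot3 (cross3 a₁ a₂ + ε • η + ε ^ 2 • ζ) (cross3 a₁ a₂ + ε • η + ε ^ 2 • ζ))
    (fun ε => by
      rw [hNsq, ← hdot]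
      generalize cross3 a₁ a₂ = v
      simp only [dot3, Pi.add_apply, Pi.smul_apply, smul_eq_mul]
      ring)
    (fun ε => dot3_self_nonneg _)
  simpa only [norm3, mul_assoc] using key
end
end

section
/- Let h, V₁, V₂, W₁, W₂ : D × (0,T) → ℝ be smooth with h > 0, and define on D × [0,1] × (0,T): u₁ = (W₁ − V₁)ξ₃ + V₁, u₂ = (W₂ − V₂)ξ₃ + V₂, u₃ = (∂X/∂t)·a₃. Suppose w : D × [0,1] × (0,T) → ℝ is differentiable in ξ₃, vanishes on ξ₃ = 0, and satisfies on D × (0,1) × (0,T) the incompressibility relation (1/h)·∂w/∂ξ₃ = −(∂A⁰/∂ξ₁/(2A⁰))·u₁ − (∂A⁰/∂ξ₂/(2A⁰))·u₂ − (A¹/A⁰)·u₃ − ∂u₁/∂ξ₁ − ∂u₂/∂ξ₂ + (ξ₃/h)·(∂u₁/∂ξ₃·∂h/∂ξ₁ + ∂u₂/∂ξ₃·∂h/∂ξ₂). Then w is given explicitly by w = (ξ₃²/2)·[(W − V)·∇h − (h/√A⁰)·div(√A⁰·(W − V))] − hξ₃·[(1/√A⁰)·div(√A⁰·V) + (A¹/A⁰)·((∂X/∂t)·a₃)],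 where V = (V₁, V₂) and W = (W₁, W₂). -/
noncomputable section

theorem gram_pos_aux (a b : Fin 3 → ℝ) (hl : LinearIndependent ℝ ![a, b]) :
    0 < dot3 a a * dot3 b b - (dot3 a b) ^ 2 := by
  rw [LinearIndependent.pair_iff] at hl
  by_contra hcon
  push Not at hcon
  have hG : 0 ≤ dot3 b b := by unfold dot3; nlinarith [sq_nonneg (b 0), sq_nonneg (b 1), sq_nonneg (b 2)]
  have key : (dot3 b b * a 0 - dot3 a b * b 0) ^ 2 + (dot3 b b * a 1 - dot3 a b * b 1) ^ 2
      + (dot3 b b * a 2 - dot3 a b * b 2) ^ 2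
      = dot3 b b * (dot3 a a * dot3 b b - (dot3 a b) ^ 2) := by
    unfold dot3; ring
  have hle := mul_nonpos_of_nonneg_of_nonpos hG hcon
  have sq3 : ∀ x y z : ℝ, x ^ 2 + y ^ 2 + z ^ 2 ≤ 0 → x = 0 ∧ y = 0 ∧ z = 0 := by
    intro x y z hh
    refine ⟨?_, ?_, ?_⟩ <;> apply pow_eq_zero_iff (two_ne_zero) |>.1 <;>
      nlinarith [sq_nonneg x, sq_nonneg y, sq_nonneg z]
  obtain ⟨h0, h1, h2⟩ := sq3 _ _ _ (key.trans_le hle)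
  have hz := hl (dot3 b b) (-dot3 a b) (by
    ext i
    fin_cases i
    · simp; linarith
    · simp; linarith
    · simp; linarith)
  obtain ⟨g0, g1, g2⟩ := sq3 (b 0) (b 1) (b 2) (by
    have := hz.1
    unfold dot3 at this
    nlinarith)
  have := hl 0 1 (by
    ext i
    fin_cases i
    · simp [g0]
    · simp [g1]
    · simp [g2])
  exact one_ne_zero this.2

theorem ode_aux (w : ℝ → ℝ) (P Q : ℝ)
    (hd : ∀ x ∈ Set.Icc (0 : ℝ) 1, DifferentiableAt ℝ w x) (h0 : w 0 = 0)
    (hw : ∀ x ∈ Set.Ioo (0 : ℝ) 1, deriv w x = x * P - Q) :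
    ∀ x ∈ Set.Icc (0 : ℝ) 1, w x = x ^ 2 / 2 * P - x * Q := by
  intro x hx
  rcases eq_or_lt_of_le hx.1 with h | hpos
  · subst h; simp [h0]
  have hder : ∀ y ∈ Set.Icc (0 : ℝ) 1,
      HasDerivAt (fun z => w z - (z ^ 2 / 2 * P - z * Q)) (deriv w y - (y * P - Q)) y := by
    intro y hy
    have e1 : HasDerivAt (fun z : ℝ => z ^ 2 / 2 * P - z * Q) (y * P - Q) y := by
      have := ((((hasDerivAt_id y).pow 2).div_const 2).mul_const P).sub
        ((hasDerivAt_id y).mul_const Q)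
      refine this.congr_deriv ?_
      simp only [id]
      push_cast
      ring
    exact (hd y hy).hasDerivAt.sub e1
  obtain ⟨c, hc, hcs⟩ := exists_hasDerivAt_eq_slope
    (fun z => w z - (z ^ 2 / 2 * P - z * Q)) (fun y => deriv w y - (y * P - Q)) hpos
    (fun y hy => (hder y ⟨hy.1, hy.2.trans hx.2⟩).continuousAt.continuousWithinAt)
    (fun y hy => hder y ⟨hy.1.le, hy.2.le.trans hx.2⟩)
  rw [hw c ⟨hc.1, hc.2.trans_le hx.2⟩, sub_self, eq_comm, div_eq_zero_iff] at hcs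
  rcases hcs with h | h
  · simp [h0] at h; linarith
  · linarith

theorem fderiv_sqrt_mul_aux (A f : ℝ × ℝ × ℝ → ℝ) (q v : ℝ × ℝ × ℝ)
    (hA : DifferentiableAt ℝ A q) (hf : DifferentiableAt ℝ f q) (hpos : 0 < A q) :
    fderiv ℝ (fun q' => Real.sqrt (A q') * f q') q v
      = Real.sqrt (A q) * (fderiv ℝ f q v + fderiv ℝ A q v / (2 * A q) * f q) := by
  have := ((hA.hasFDerivAt.sqrt hpos.ne').mul hf.hasFDerivAt).fderiv
  have e : (fun q' => Real.sqrt (A q') * f q') = (fun q' => Real.sqrt (A q')) * f := rfl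
  rw [e, this]
  have hs : Real.sqrt (A q) ≠ 0 := (Real.sqrt_pos.2 hpos).ne'
  have hss : A q = Real.sqrt (A q) ^ 2 := (Real.sq_sqrt hpos.le).symm
  simp only [ContinuousLinearMap.add_apply, ContinuousLinearMap.smul_apply, smul_eq_mul]
  generalize Real.sqrt (A q) = s at *
  rw [hss]
  field_simp

/-- Explicit formula for the vertical velocity `w` determined by the incompressibility
relation, `w = 0` on `ξ₃ = 0`, for the linear-in-`ξ₃` velocity profiles. -/
theorem stmt10
    (D : Set (ℝ × ℝ)) (hD : IsOpen D) (T : ℝ) (hT : 0 < T)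
    (S : Set (ℝ × ℝ × ℝ))
    (hSdef : S = {q : ℝ × ℝ × ℝ | (q.1, q.2.1) ∈ D ∧ q.2.2 ∈ Set.Ioo 0 T})
    (X : ℝ × ℝ × ℝ → Fin 3 → ℝ) (hX : ContDiffOn ℝ (⊤ : ℕ∞) X S)
    (a₁ a₂ a₃ : ℝ × ℝ × ℝ → Fin 3 → ℝ)
    (ha₁ : ∀ q, a₁ q = pd1 X q) (ha₂ : ∀ q, a₂ q = pd2 X q)
    (hli : ∀ q ∈ S, LinearIndependent ℝ ![a₁ q, a₂ q])
    (ha₃ : ∀ q, a₃ q = (norm3 (cross3 (a₁ q) (a₂ q)))⁻¹ • cross3 (a₁ q) (a₂ q))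
    (Ec Fc Gc A0 ec fc gc A1 : ℝ × ℝ × ℝ → ℝ)
    (hE : ∀ q, Ec q = dot3 (a₁ q) (a₁ q))
    (hF : ∀ q, Fc q = dot3 (a₁ q) (a₂ q))
    (hG : ∀ q, Gc q = dot3 (a₂ q) (a₂ q))
    (hA0 : ∀ q, A0 q = Ec q * Gc q - (Fc q) ^ 2)
    (he : ∀ q, ec q = -dot3 (a₁ q) (pd1 a₃ q))
    (hf : ∀ q, fc q = -dot3 (a₁ q) (pd2 a₃ q))
    (hg : ∀ q, gc q = -dot3 (a₂ q) (pd2 a₃ q))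
    (hA1 : ∀ q, A1 q = -(ec q) * Gc q - gc q * Ec q + 2 * fc q * Fc q)
    (h V₁ V₂ W₁ W₂ : ℝ × ℝ × ℝ → ℝ)
    (hhs : ContDiffOn ℝ (⊤ : ℕ∞) h S)
    (hV₁s : ContDiffOn ℝ (⊤ : ℕ∞) V₁ S) (hV₂s : ContDiffOn ℝ (⊤ : ℕ∞) V₂ S)
    (hW₁s : ContDiffOn ℝ (⊤ : ℕ∞) W₁ S) (hW₂s : ContDiffOn ℝ (⊤ : ℕ∞) W₂ S)
    (hhpos : ∀ q ∈ S, 0 < h q)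
    (u₁ u₂ : ℝ × ℝ × ℝ → ℝ → ℝ) (u₃ : ℝ × ℝ × ℝ → ℝ)
    (hu₁ : ∀ q, ∀ ξ₃ : ℝ, u₁ q ξ₃ = (W₁ q - V₁ q) * ξ₃ + V₁ q)
    (hu₂ : ∀ q, ∀ ξ₃ : ℝ, u₂ q ξ₃ = (W₂ q - V₂ q) * ξ₃ + V₂ q)
    (hu₃ : ∀ q, u₃ q = dot3 (pdt X q) (a₃ q))
    (w : ℝ × ℝ × ℝ → ℝ → ℝ)
    (hwdiff : ∀ q ∈ S, ∀ ξ₃ ∈ Set.Icc (0 : ℝ) 1, DifferentiableAt ℝ (w q) ξ₃)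
    (hw0 : ∀ q ∈ S, w q 0 = 0)
    (hinc : ∀ q ∈ S, ∀ ξ₃ ∈ Set.Ioo (0 : ℝ) 1,
        (1 / h q) * deriv (w q) ξ₃ =
          -(pd1 A0 q / (2 * A0 q)) * u₁ q ξ₃ - (pd2 A0 q / (2 * A0 q)) * u₂ q ξ₃
            - (A1 q / A0 q) * u₃ q
            - pd1 (fun q' => u₁ q' ξ₃) q - pd2 (fun q' => u₂ q' ξ₃) q
            + (ξ₃ / h q) * (deriv (u₁ q) ξ₃ * pd1 h q + deriv (u₂ q) ξ₃ * pd2 h q)) :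
    ∀ q ∈ S, ∀ ξ₃ ∈ Set.Icc (0 : ℝ) 1,
      w q ξ₃ =
        ξ₃ ^ 2 / 2 *
            ((W₁ q - V₁ q) * pd1 h q + (W₂ q - V₂ q) * pd2 h q
              - (h q / Real.sqrt (A0 q)) *
                  (pd1 (fun q' => Real.sqrt (A0 q') * (W₁ q' - V₁ q')) q
                    + pd2 (fun q' => Real.sqrt (A0 q') * (W₂ q' - V₂ q')) q))
          - h q * ξ₃ *
              ((1 / Real.sqrt (A0 q)) *
                  (pd1 (fun q' => Real.sqrt (A0 q') * V₁ q') q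
                    + pd2 (fun q' => Real.sqrt (A0 q') * V₂ q') q)
                + (A1 q / A0 q) * dot3 (pdt X q) (a₃ q)) := by
  intro q hq
  have hSo : IsOpen S := by
    rw [hSdef]
    exact (hD.preimage (by fun_prop : Continuous fun q : ℝ × ℝ × ℝ => (q.1, q.2.1))).inter
      (isOpen_Ioo.preimage (by fun_prop : Continuous fun q : ℝ × ℝ × ℝ => q.2.2))
  have hn : S ∈ nhds q := hSo.mem_nhds hq
  have dif : ∀ f : ℝ × ℝ × ℝ → ℝ, ContDiffOn ℝ (⊤ : ℕ∞) f S → DifferentiableAt ℝ f q :=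
    fun f hf => (hf.contDiffAt hn).differentiableAt (by simp)
  have dV₁ := dif _ hV₁s
  have dV₂ := dif _ hV₂s
  have dW₁ := dif _ hW₁s
  have dW₂ := dif _ hW₂s
  have hh := hhpos q hq
  have hApos : 0 < A0 q := by
    rw [hA0, hE, hF, hG]
    exact gram_pos_aux _ _ (hli q hq)
  have dX : DifferentiableAt ℝ (fderiv ℝ X) q :=
    ((hX.contDiffAt hn).fderiv_right (m := 1) (by norm_cast)).differentiableAt (by simp)
  have dA1 : DifferentiableAt ℝ a₁ q := by
    have : a₁ = fun q => fderiv ℝ X q (1, 0, 0) := funext ha₁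
    rw [this]
    exact dX.clm_apply (differentiableAt_const _)
  have dA2 : DifferentiableAt ℝ a₂ q := by
    have : a₂ = fun q => fderiv ℝ X q (0, 1, 0) := funext ha₂
    rw [this]
    exact dX.clm_apply (differentiableAt_const _)
  have dA : DifferentiableAt ℝ A0 q := by
    have : A0 = fun q => dot3 (a₁ q) (a₁ q) * dot3 (a₂ q) (a₂ q) - (dot3 (a₁ q) (a₂ q)) ^ 2 := by
      funext q
      rw [hA0, hE, hF, hG]
    rw [this]
    have c1 := differentiableAt_pi.1 dA1
    have c2 := differentiableAt_pi.1 dA2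
    have c10 := c1 0
    have c11 := c1 1
    have c12 := c1 2
    have c20 := c2 0
    have c21 := c2 1
    have c22 := c2 2
    unfold dot3
    fun_prop
  have hsub : ∀ (f g : ℝ × ℝ × ℝ → ℝ) (v : ℝ × ℝ × ℝ), DifferentiableAt ℝ f q →
      DifferentiableAt ℝ g q →
      fderiv ℝ (fun q' => f q' - g q') q v = fderiv ℝ f q v - fderiv ℝ g q v := by
    intro f g v hf hg
    rw [fderiv_fun_sub hf hg]; rfl
  have hlin : ∀ (f g : ℝ × ℝ × ℝ → ℝ) (x : ℝ) (v : ℝ × ℝ × ℝ), DifferentiableAt ℝ f q →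
      DifferentiableAt ℝ g q →
      fderiv ℝ (fun q' => (f q' - g q') * x + g q') q v
        = (fderiv ℝ f q v - fderiv ℝ g q v) * x + fderiv ℝ g q v := by
    intro f g x v hf hg
    have := (((hf.hasFDerivAt.sub hg.hasFDerivAt).mul_const x).add hg.hasFDerivAt).fderiv
    have e : (fun q' => (f q' - g q') * x + g q') = (fun q' => (f - g) q' * x) + g := rfl
    rw [e, this]
    simp
    ring
  have hdu : ∀ (a b x : ℝ), deriv (fun z : ℝ => a * z + b) x = a := by
    intro a b x
    simpa using (((hasDerivAt_id x).const_mul a).add_const b).deriv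
  have hode := ode_aux (w q)
    ((W₁ q - V₁ q) * pd1 h q + (W₂ q - V₂ q) * pd2 h q
      - h q * (pd1 W₁ q - pd1 V₁ q + pd1 A0 q / (2 * A0 q) * (W₁ q - V₁ q)
        + (pd2 W₂ q - pd2 V₂ q + pd2 A0 q / (2 * A0 q) * (W₂ q - V₂ q))))
    (h q * (pd1 V₁ q + pd1 A0 q / (2 * A0 q) * V₁ q
        + (pd2 V₂ q + pd2 A0 q / (2 * A0 q) * V₂ q)
        + (A1 q / A0 q) * dot3 (pdt X q) (a₃ q)))
    (hwdiff q hq) (hw0 q hq) (by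
      intro x hx
      have hi := hinc q hq x hx
      have e1 : u₁ q = fun z => (W₁ q - V₁ q) * z + V₁ q := funext (hu₁ q)
      have e2 : u₂ q = fun z => (W₂ q - V₂ q) * z + V₂ q := funext (hu₂ q)
      have p1 : pd1 (fun q' => u₁ q' x) q = (pd1 W₁ q - pd1 V₁ q) * x + pd1 V₁ q := by
        simp only [hu₁]
        exact hlin _ _ _ _ dW₁ dV₁
      have p2 : pd2 (fun q' => u₂ q' x) q = (pd2 W₂ q - pd2 V₂ q) * x + pd2 V₂ q := by
        simp only [hu₂]
        exact hlin _ _ _ _ dW₂ dV₂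
      rw [p1, p2, e1, e2, hdu, hdu, hu₃] at hi
      have hi2 : deriv (w q) x = h q * (1 / h q * deriv (w q) x) := by
        field_simp
      rw [hi2, hi]
      generalize pd1 A0 q / (2 * A0 q) = α
      generalize pd2 A0 q / (2 * A0 q) = β
      generalize A1 q / A0 q = γ
      field_simp
      ring)
  intro x hx
  rw [hode x hx]
  have hs : Real.sqrt (A0 q) ≠ 0 := (Real.sqrt_pos.2 hApos).ne'
  have r1 : pd1 (fun q' => Real.sqrt (A0 q') * (W₁ q' - V₁ q')) q
      = Real.sqrt (A0 q) * (pd1 W₁ q - pd1 V₁ q + pd1 A0 q / (2 * A0 q) * (W₁ q - V₁ q)) := by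
    unfold pd1
    rw [← hsub _ _ _ dW₁ dV₁]
    exact fderiv_sqrt_mul_aux A0 (fun q' => W₁ q' - V₁ q') q _ dA (dW₁.sub dV₁) hApos
  have r2 : pd2 (fun q' => Real.sqrt (A0 q') * (W₂ q' - V₂ q')) q
      = Real.sqrt (A0 q) * (pd2 W₂ q - pd2 V₂ q + pd2 A0 q / (2 * A0 q) * (W₂ q - V₂ q)) := by
    unfold pd2
    rw [← hsub _ _ _ dW₂ dV₂]
    exact fderiv_sqrt_mul_aux A0 (fun q' => W₂ q' - V₂ q') q _ dA (dW₂.sub dV₂) hApos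
  have r3 : pd1 (fun q' => Real.sqrt (A0 q') * V₁ q') q
      = Real.sqrt (A0 q) * (pd1 V₁ q + pd1 A0 q / (2 * A0 q) * V₁ q) :=
    fderiv_sqrt_mul_aux A0 V₁ q _ dA dV₁ hApos
  have r4 : pd2 (fun q' => Real.sqrt (A0 q') * V₂ q') q
      = Real.sqrt (A0 q) * (pd2 V₂ q + pd2 A0 q / (2 * A0 q) * V₂ q) :=
    fderiv_sqrt_mul_aux A0 V₂ q _ dA dV₂ hApos
  rw [r1, r2, r3, r4]
  generalize pd1 A0 q / (2 * A0 q) = α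
  generalize pd2 A0 q / (2 * A0 q) = β
  generalize A1 q / A0 q = γ
  generalize Real.sqrt (A0 q) = s at *
  field_simp
end
end

section
/- Let h, V₁, V₂, W₁, W₂ : D × (0,T) → ℝ be smooth with h > 0, and define on D × [0,1] × (0,T): u₁ = (W₁ − V₁)ξ₃ + V₁, u₂ = (W₂ − V₂)ξ₃ + V₂, u₃ = (∂X/∂t)·a₃. Suppose there exists w : D × [0,1] × (0,T) → ℝ, differentiable in ξ₃, with w = 0 on ξ₃ = 0 and w = ∂h/∂t on ξ₃ = 1, satisfying on D × (0,1) × (0,T) the incompressibility relation (1/h)·∂w/∂ξ₃ = −(∂A⁰/∂ξ₁/(2A⁰))·u₁ − (∂A⁰/∂ξ₂/(2A⁰))·u₂ − (A¹/A⁰)·u₃ − ∂u₁/∂ξ₁ − ∂u₂/∂ξ₂ + (ξ₃/h)·(∂u₁/∂ξ₃·∂h/∂ξ₁ + ∂u₂/∂ξ₃·∂h/∂ξ₂). Then on D × (0,T) the mass conservation equation holds: 2·∂h/∂t − (W − V)·∇h + (h/√A⁰)·div(√A⁰·(W + V)) + (2hA¹/A⁰)·((∂X/∂t)·a₃) = 0,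 where V = (V₁, V₂) and W = (W₁, W₂). -/
noncomputable section

theorem integrate_aux (w : ℝ → ℝ) (P Q : ℝ)
    (hd : ∀ x ∈ Set.Icc (0 : ℝ) 1, DifferentiableAt ℝ w x)
    (hw : ∀ x ∈ Set.Ioo (0 : ℝ) 1, deriv w x = P + Q * x) :
    w 1 - w 0 = P + Q / 2 := by
  have hdp : ∀ x : ℝ, HasDerivAt (fun x : ℝ => P * x + Q * (x ^ 2 / 2)) (P + Q * x) x := by
    intro x
    have := ((hasDerivAt_id x).const_mul P).add
      ((((hasDerivAt_id x).pow 2).div_const 2).const_mul Q)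
    refine this.congr_deriv ?_
    simp
  have hg : ∀ x ∈ Set.Icc (0 : ℝ) 1,
      HasDerivAt (fun x => w x - (P * x + Q * (x ^ 2 / 2))) (deriv w x - (P + Q * x)) x :=
    fun x hx => (hd x hx).hasDerivAt.sub (hdp x)
  obtain ⟨c, hc, hcs⟩ := exists_hasDerivAt_eq_slope
    (fun x => w x - (P * x + Q * (x ^ 2 / 2))) (fun x => deriv w x - (P + Q * x))
    (zero_lt_one) (fun x hx => (hg x hx).continuousAt.continuousWithinAt)
    (fun x hx => hg x (Set.Ioo_subset_Icc_self hx))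
  simp only [hw c hc] at hcs
  norm_num at hcs
  linarith

/-- Mass conservation: if the incompressibility relation holds for some `w` with `w = 0`
on `ξ₃ = 0` and `w = ∂h/∂t` on `ξ₃ = 1`, then
`2·∂h/∂t − (W − V)·∇h + (h/√A⁰)·div(√A⁰(W + V)) + (2hA¹/A⁰)·((∂X/∂t)·a₃) = 0`. -/
theorem stmt11
    (D : Set (ℝ × ℝ)) (hD : IsOpen D) (T : ℝ) (hT : 0 < T)
    (S : Set (ℝ × ℝ × ℝ))
    (hSdef : S = {q : ℝ × ℝ × ℝ | (q.1, q.2.1) ∈ D ∧ q.2.2 ∈ Set.Ioo 0 T})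
    (X : ℝ × ℝ × ℝ → Fin 3 → ℝ) (hX : ContDiffOn ℝ (⊤ : ℕ∞) X S)
    (a₁ a₂ a₃ : ℝ × ℝ × ℝ → Fin 3 → ℝ)
    (ha₁ : ∀ q, a₁ q = pd1 X q) (ha₂ : ∀ q, a₂ q = pd2 X q)
    (hli : ∀ q ∈ S, LinearIndependent ℝ ![a₁ q, a₂ q])
    (ha₃ : ∀ q, a₃ q = (norm3 (cross3 (a₁ q) (a₂ q)))⁻¹ • cross3 (a₁ q) (a₂ q))
    (Ec Fc Gc A0 ec fc gc A1 : ℝ × ℝ × ℝ → ℝ)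
    (hE : ∀ q, Ec q = dot3 (a₁ q) (a₁ q))
    (hF : ∀ q, Fc q = dot3 (a₁ q) (a₂ q))
    (hG : ∀ q, Gc q = dot3 (a₂ q) (a₂ q))
    (hA0 : ∀ q, A0 q = Ec q * Gc q - (Fc q) ^ 2)
    (he : ∀ q, ec q = -dot3 (a₁ q) (pd1 a₃ q))
    (hf : ∀ q, fc q = -dot3 (a₁ q) (pd2 a₃ q))
    (hg : ∀ q, gc q = -dot3 (a₂ q) (pd2 a₃ q))
    (hA1 : ∀ q, A1 q = -(ec q) * Gc q - gc q * Ec q + 2 * fc q * Fc q)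
    (h V₁ V₂ W₁ W₂ : ℝ × ℝ × ℝ → ℝ)
    (hhs : ContDiffOn ℝ (⊤ : ℕ∞) h S)
    (hV₁s : ContDiffOn ℝ (⊤ : ℕ∞) V₁ S) (hV₂s : ContDiffOn ℝ (⊤ : ℕ∞) V₂ S)
    (hW₁s : ContDiffOn ℝ (⊤ : ℕ∞) W₁ S) (hW₂s : ContDiffOn ℝ (⊤ : ℕ∞) W₂ S)
    (hhpos : ∀ q ∈ S, 0 < h q)
    (u₁ u₂ : ℝ × ℝ × ℝ → ℝ → ℝ) (u₃ : ℝ × ℝ × ℝ → ℝ)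
    (hu₁ : ∀ q, ∀ ξ₃ : ℝ, u₁ q ξ₃ = (W₁ q - V₁ q) * ξ₃ + V₁ q)
    (hu₂ : ∀ q, ∀ ξ₃ : ℝ, u₂ q ξ₃ = (W₂ q - V₂ q) * ξ₃ + V₂ q)
    (hu₃ : ∀ q, u₃ q = dot3 (pdt X q) (a₃ q))
    (w : ℝ × ℝ × ℝ → ℝ → ℝ)
    (hwdiff : ∀ q ∈ S, ∀ ξ₃ ∈ Set.Icc (0 : ℝ) 1, DifferentiableAt ℝ (w q) ξ₃)
    (hw0 : ∀ q ∈ S, w q 0 = 0)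
    (hw1 : ∀ q ∈ S, w q 1 = pdt h q)
    (hinc : ∀ q ∈ S, ∀ ξ₃ ∈ Set.Ioo (0 : ℝ) 1,
        (1 / h q) * deriv (w q) ξ₃ =
          -(pd1 A0 q / (2 * A0 q)) * u₁ q ξ₃ - (pd2 A0 q / (2 * A0 q)) * u₂ q ξ₃
            - (A1 q / A0 q) * u₃ q
            - pd1 (fun q' => u₁ q' ξ₃) q - pd2 (fun q' => u₂ q' ξ₃) q
            + (ξ₃ / h q) * (deriv (u₁ q) ξ₃ * pd1 h q + deriv (u₂ q) ξ₃ * pd2 h q)) :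
    ∀ q ∈ S,
      2 * pdt h q
          - ((W₁ q - V₁ q) * pd1 h q + (W₂ q - V₂ q) * pd2 h q)
          + (h q / Real.sqrt (A0 q)) *
              (pd1 (fun q' => Real.sqrt (A0 q') * (W₁ q' + V₁ q')) q
                + pd2 (fun q' => Real.sqrt (A0 q') * (W₂ q' + V₂ q')) q)
          + (2 * h q * A1 q / A0 q) * dot3 (pdt X q) (a₃ q) = 0 := by
  intro q hq
  have hSo : IsOpen S := by
    rw [hSdef]
    have c1 : Continuous (fun q : ℝ × ℝ × ℝ => (q.1, q.2.1)) := by fun_prop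
    have c2 : Continuous (fun q : ℝ × ℝ × ℝ => q.2.2) := by fun_prop
    exact (hD.preimage c1).inter (isOpen_Ioo.preimage c2)
  have hn := hSo.mem_nhds hq
  have hne : ((⊤ : ℕ∞) : WithTop ℕ∞) ≠ 0 := by simp
  have dV₁ := (hV₁s.contDiffAt hn).differentiableAt hne
  have dV₂ := (hV₂s.contDiffAt hn).differentiableAt hne
  have dW₁ := (hW₁s.contDiffAt hn).differentiableAt hne
  have dW₂ := (hW₂s.contDiffAt hn).differentiableAt hne
  have dX : DifferentiableAt ℝ (fderiv ℝ X) q :=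
    ((hX.contDiffAt hn).fderiv_right (m := 1) (by norm_cast)).differentiableAt
      (by simp)
  have dXv : ∀ (v : ℝ × ℝ × ℝ) (i : Fin 3), DifferentiableAt ℝ (fun q => fderiv ℝ X q v i) q :=
    fun v i => differentiableAt_pi.1 (dX.clm_apply (differentiableAt_const v)) i
  have hApos : 0 < A0 q := by
    rw [hA0, hE, hF, hG]; exact gram_pos_aux _ _ (hli q hq)
  have dA : DifferentiableAt ℝ A0 q := by
    have hfun : A0 = fun q => dot3 (pd1 X q) (pd1 X q) * dot3 (pd2 X q) (pd2 X q)
        - (dot3 (pd1 X q) (pd2 X q)) ^ 2 := by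
      funext q; rw [hA0, hE, hF, hG, ha₁, ha₂]
    rw [hfun]
    unfold dot3 pd1 pd2
    have p := dXv (1, 0, 0)
    have r := dXv (0, 1, 0)
    have p0 := p 0
    have p1 := p 1
    have p2 := p 2
    have r0 := r 0
    have r1 := r 1
    have r2 := r 2
    fun_prop
  have hp := hhpos q hq
  have key := integrate_aux (w q)
    (h q * (-(pd1 A0 q / (2 * A0 q)) * V₁ q - (pd2 A0 q / (2 * A0 q)) * V₂ q
      - (A1 q / A0 q) * u₃ q - pd1 V₁ q - pd2 V₂ q))
    (h q * (-(pd1 A0 q / (2 * A0 q)) * (W₁ q - V₁ q) - (pd2 A0 q / (2 * A0 q)) * (W₂ q - V₂ q)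
      - (pd1 W₁ q - pd1 V₁ q) - (pd2 W₂ q - pd2 V₂ q))
      + ((W₁ q - V₁ q) * pd1 h q + (W₂ q - V₂ q) * pd2 h q))
    (hwdiff q hq) (by
      intro x hx
      have hx' := hinc q hq x hx
      have du : ∀ (u : ℝ × ℝ × ℝ → ℝ → ℝ) (W V : ℝ × ℝ × ℝ → ℝ),
          (∀ q, ∀ y : ℝ, u q y = (W q - V q) * y + V q) → deriv (u q) x = W q - V q := by
        intro u W V hu
        have : u q = fun y => (W q - V q) * y + V q := funext (hu q)
        rw [this]
        simp
      have pu : ∀ (u : ℝ × ℝ × ℝ → ℝ → ℝ) (W V : ℝ × ℝ × ℝ → ℝ) (v : ℝ × ℝ × ℝ),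
          (∀ q, ∀ y : ℝ, u q y = (W q - V q) * y + V q) → DifferentiableAt ℝ W q →
          DifferentiableAt ℝ V q → fderiv ℝ (fun q' => u q' x) q v
            = (fderiv ℝ W q v - fderiv ℝ V q v) * x + fderiv ℝ V q v := by
        intro u W V v hu hW hV
        have : (fun q' => u q' x) = fun q' => (W q' - V q') * x + V q' :=
          funext fun q' => hu q' x
        rw [this]
        have h1 := (((hW.hasFDerivAt.sub hV.hasFDerivAt).mul_const x).add hV.hasFDerivAt).fderiv
        have := congrArg (fun L => L v) h1
        simp at this
        refine Eq.trans this ?_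
        ring
      rw [du u₁ W₁ V₁ hu₁, du u₂ W₂ V₂ hu₂, hu₁, hu₂] at hx'
      have e1 := pu u₁ W₁ V₁ (1, 0, 0) hu₁ dW₁ dV₁
      have e2 := pu u₂ W₂ V₂ (0, 1, 0) hu₂ dW₂ dV₂
      change pd1 _ q = (pd1 W₁ q - pd1 V₁ q) * x + pd1 V₁ q at e1
      change pd2 _ q = (pd2 W₂ q - pd2 V₂ q) * x + pd2 V₂ q at e2
      rw [e1, e2] at hx'
      have h3 : deriv (w q) x = h q * (1 / h q * deriv (w q) x) := by field_simp
      rw [h3, hx']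
      generalize pd1 A0 q / (2 * A0 q) = α
      generalize pd2 A0 q / (2 * A0 q) = β
      generalize A1 q / A0 q = γ
      field_simp
      ring)
  rw [hw0 q hq, hw1 q hq, hu₃] at key
  have f1 := fderiv_sqrt_mul_aux A0 (fun q' => W₁ q' + V₁ q') q (1, 0, 0) dA (dW₁.add dV₁) hApos
  have f2 := fderiv_sqrt_mul_aux A0 (fun q' => W₂ q' + V₂ q') q (0, 1, 0) dA (dW₂.add dV₂) hApos
  rw [fderiv_fun_add dW₁ dV₁] at f1
  rw [fderiv_fun_add dW₂ dV₂] at f2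
  change pd1 _ q = Real.sqrt (A0 q) * ((pd1 W₁ q + pd1 V₁ q)
    + pd1 A0 q / (2 * A0 q) * (W₁ q + V₁ q)) at f1
  change pd2 _ q = Real.sqrt (A0 q) * ((pd2 W₂ q + pd2 V₂ q)
    + pd2 A0 q / (2 * A0 q) * (W₂ q + V₂ q)) at f2
  have hs : Real.sqrt (A0 q) ≠ 0 := (Real.sqrt_pos.2 hApos).ne'
  rw [f1, f2, ← mul_add, ← mul_assoc, div_mul_cancel₀ _ hs,
    show 2 * h q * A1 q / A0 q = 2 * h q * (A1 q / A0 q) by ring]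
  linear_combination 2 * key
end
end

section
/- Let μ > 0 and let h, V₁, V₂, W₁, W₂, π₀ : D × (0,T) → ℝ be smooth with h > 0. Define on D × [0,1] × (0,T) the function w = (ξ₃²/2)·[(W − V)·∇h − (h/√A⁰)·div(√A⁰·(W − V))] − hξ₃·[(1/√A⁰)·div(√A⁰·V) + (A¹/A⁰)·((∂X/∂t)·a₃)], with V = (V₁, V₂), W = (W₁, W₂). Suppose P : D × [0,1] × (0,T) → ℝ is differentiable in ξ₃ and satisfies h·∂P/∂ξ₃ = μ·∂²w/∂ξ₃² on D × (0,1) × (0,T), together with the boundary condition −P + (2μ/h)·∂w/∂ξ₃ = −π₀ on ξ₃ = 0. Then for all ξ₃ ∈ [0,1]: P = (μξ₃/h)·[(W − V)·∇h − (h/√A⁰)·div(√A⁰·(W − V))] − (2μ/√A⁰)·div(√A⁰·V) − (2μA¹/A⁰)·((∂X/∂t)·a₃) + π₀. -/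
noncomputable section

/-- The one-variable computation behind the pressure formula. -/
theorem pressure_aux (μ h B C p : ℝ) (hh : 0 < h) (w P : ℝ → ℝ)
    (hw : ∀ x, w x = x ^ 2 / 2 * B - h * x * C)
    (hP : ∀ x ∈ Set.Icc (0 : ℝ) 1, DifferentiableAt ℝ P x)
    (hode : ∀ x ∈ Set.Ioo (0 : ℝ) 1, h * deriv P x = μ * deriv (deriv w) x)
    (hbc : -(P 0) + (2 * μ / h) * deriv w 0 = -p) :
    ∀ x ∈ Set.Icc (0 : ℝ) 1, P x = μ * x / h * B - 2 * μ * C + p := by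
  have hd : ∀ x, HasDerivAt w (x * B - h * C) x := by
    intro x
    have e : w = fun x => x ^ 2 / 2 * B - h * x * C := funext hw
    rw [e]
    have h1 := ((((hasDerivAt_id x).pow 2).div_const 2).mul_const B).sub
      (((hasDerivAt_id x).const_mul h).mul_const C)
    refine HasDerivAt.congr_deriv h1 ?_
    norm_num
  have hd1 : deriv w = fun x => x * B - h * C := funext fun x => (hd x).deriv
  have hd2 : ∀ x, deriv (deriv w) x = B := by
    intro x
    rw [hd1]
    have h1 := ((hasDerivAt_id x).mul_const B).sub_const (h * C)
    simpa using h1.deriv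
  have hne : h ≠ 0 := hh.ne'
  have hP0 : P 0 = p - 2 * μ * C := by
    rw [hd1] at hbc
    field_simp at hbc
    have : h * (P 0) = h * (p - 2 * μ * C) := by linarith
    exact mul_left_cancel₀ hne this
  intro x hx
  rcases eq_or_lt_of_le hx.1 with h0 | h0
  · rw [← h0, hP0]; ring
  · obtain ⟨c, hc, hs⟩ := exists_deriv_eq_slope P h0
      (fun y hy => (hP y ⟨hy.1, hy.2.trans hx.2⟩).continuousAt.continuousWithinAt)
      (fun y hy => (hP y ⟨hy.1.le, hy.2.le.trans hx.2⟩).differentiableWithinAt)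
    have h2 := hode c ⟨hc.1, hc.2.trans_le hx.2⟩
    rw [hd2, hs, hP0] at h2
    have hx0 : x ≠ 0 := h0.ne'
    simp only [sub_zero] at h2
    field_simp at h2 ⊢
    linarith

/-- Zeroth-order pressure: if `P` satisfies `h·∂P/∂ξ₃ = μ·∂²w/∂ξ₃²` with the traction
boundary condition `−P + (2μ/h)·∂w/∂ξ₃ = −π₀` at `ξ₃ = 0`, where `w` is the explicit
vertical velocity, then `P` is given by the stated formula. -/
theorem stmt12
    (D : Set (ℝ × ℝ)) (hD : IsOpen D) (T : ℝ) (hT : 0 < T)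
    (S : Set (ℝ × ℝ × ℝ))
    (hSdef : S = {q : ℝ × ℝ × ℝ | (q.1, q.2.1) ∈ D ∧ q.2.2 ∈ Set.Ioo 0 T})
    (X : ℝ × ℝ × ℝ → Fin 3 → ℝ) (hX : ContDiffOn ℝ (⊤ : ℕ∞) X S)
    (a₁ a₂ a₃ : ℝ × ℝ × ℝ → Fin 3 → ℝ)
    (ha₁ : ∀ q, a₁ q = pd1 X q) (ha₂ : ∀ q, a₂ q = pd2 X q)
    (hli : ∀ q ∈ S, LinearIndependent ℝ ![a₁ q, a₂ q])
    (ha₃ : ∀ q, a₃ q = (norm3 (cross3 (a₁ q) (a₂ q)))⁻¹ • cross3 (a₁ q) (a₂ q))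
    (Ec Fc Gc A0 ec fc gc A1 : ℝ × ℝ × ℝ → ℝ)
    (hE : ∀ q, Ec q = dot3 (a₁ q) (a₁ q))
    (hF : ∀ q, Fc q = dot3 (a₁ q) (a₂ q))
    (hG : ∀ q, Gc q = dot3 (a₂ q) (a₂ q))
    (hA0 : ∀ q, A0 q = Ec q * Gc q - (Fc q) ^ 2)
    (he : ∀ q, ec q = -dot3 (a₁ q) (pd1 a₃ q))
    (hf : ∀ q, fc q = -dot3 (a₁ q) (pd2 a₃ q))
    (hg : ∀ q, gc q = -dot3 (a₂ q) (pd2 a₃ q))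
    (hA1 : ∀ q, A1 q = -(ec q) * Gc q - gc q * Ec q + 2 * fc q * Fc q)
    (μ : ℝ) (hμ : 0 < μ)
    (h V₁ V₂ W₁ W₂ π₀ : ℝ × ℝ × ℝ → ℝ)
    (hhs : ContDiffOn ℝ (⊤ : ℕ∞) h S)
    (hV₁s : ContDiffOn ℝ (⊤ : ℕ∞) V₁ S) (hV₂s : ContDiffOn ℝ (⊤ : ℕ∞) V₂ S)
    (hW₁s : ContDiffOn ℝ (⊤ : ℕ∞) W₁ S) (hW₂s : ContDiffOn ℝ (⊤ : ℕ∞) W₂ S)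
    (hπ₀s : ContDiffOn ℝ (⊤ : ℕ∞) π₀ S)
    (hhpos : ∀ q ∈ S, 0 < h q)
    (w : ℝ × ℝ × ℝ → ℝ → ℝ)
    (hw : ∀ q, ∀ ξ₃ : ℝ, w q ξ₃ =
        ξ₃ ^ 2 / 2 *
            ((W₁ q - V₁ q) * pd1 h q + (W₂ q - V₂ q) * pd2 h q
              - (h q / Real.sqrt (A0 q)) *
                  (pd1 (fun q' => Real.sqrt (A0 q') * (W₁ q' - V₁ q')) q
                    + pd2 (fun q' => Real.sqrt (A0 q') * (W₂ q' - V₂ q')) q))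
          - h q * ξ₃ *
              ((1 / Real.sqrt (A0 q)) *
                  (pd1 (fun q' => Real.sqrt (A0 q') * V₁ q') q
                    + pd2 (fun q' => Real.sqrt (A0 q') * V₂ q') q)
                + (A1 q / A0 q) * dot3 (pdt X q) (a₃ q)))
    (P : ℝ × ℝ × ℝ → ℝ → ℝ)
    (hPdiff : ∀ q ∈ S, ∀ ξ₃ ∈ Set.Icc (0 : ℝ) 1, DifferentiableAt ℝ (P q) ξ₃)
    (hode : ∀ q ∈ S, ∀ ξ₃ ∈ Set.Ioo (0 : ℝ) 1,
        h q * deriv (P q) ξ₃ = μ * deriv (deriv (w q)) ξ₃)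
    (hbc : ∀ q ∈ S, -(P q 0) + (2 * μ / h q) * deriv (w q) 0 = -(π₀ q)) :
    ∀ q ∈ S, ∀ ξ₃ ∈ Set.Icc (0 : ℝ) 1,
      P q ξ₃ =
        μ * ξ₃ / h q *
            ((W₁ q - V₁ q) * pd1 h q + (W₂ q - V₂ q) * pd2 h q
              - (h q / Real.sqrt (A0 q)) *
                  (pd1 (fun q' => Real.sqrt (A0 q') * (W₁ q' - V₁ q')) q
                    + pd2 (fun q' => Real.sqrt (A0 q') * (W₂ q' - V₂ q')) q))
          - (2 * μ / Real.sqrt (A0 q)) *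
              (pd1 (fun q' => Real.sqrt (A0 q') * V₁ q') q
                + pd2 (fun q' => Real.sqrt (A0 q') * V₂ q') q)
          - (2 * μ * A1 q / A0 q) * dot3 (pdt X q) (a₃ q)
          + π₀ q := by
  intro q hq x hx
  have key := pressure_aux μ (h q) _ _ (π₀ q) (hhpos q hq) (w q) (P q) (hw q)
    (hPdiff q hq) (hode q hq) (hbc q hq) x hx
  rw [key]
  ring
end
end
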